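/- Let Λ ⊂ ℝⁿ (n ≥ 2) be a lattice invariant under a reflection ρ ∈ O(n) (a linear isometry whose fixed subspace is a hyperplane), i.e. ρ(Λ) = Λ. Then there exists a nonzero harmonic homogeneous quadratic polynomial h on ℝⁿ with Θ_{h;Λ} identically zero on the upper half plane; explicitly, in orthonormal coordinates x₁, …, x_n with ρ*x₁ = −x₁ and ρ*x₂ = x₂, one has Θ_{x₁x₂;Λ} = 0. -/

import Mathlib

open scoped BigOperators

noncomputable section

/-- The value ᵗv B v of the quadratic form attached to the matrix `B`. -/
def QF {n : ℕ} (B : Matrix (Fin n) (Fin n) ℝ) (v : Fin n → ℝ) : ℝ :=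
  ∑ i, ∑ j, B i j * v i * v j

/-- The standard Euclidean inner product on `ℝⁿ`. -/
def ip {n : ℕ} (v w : Fin n → ℝ) : ℝ := ∑ i, v i * w i

/-- The squared Euclidean norm on `ℝⁿ`. -/
def nsq {n : ℕ} (v : Fin n → ℝ) : ℝ := ∑ i, v i ^ 2

/-- `q^t = exp(2 π i t τ)`. -/
def eq2 (t : ℝ) (τ : ℂ) : ℂ := Complex.exp (2 * Real.pi * Complex.I * t * τ)

/-- The lattice vector `Σᵢ cᵢ bᵢ` attached to the integer coefficient vector `c`. -/
def LV {n : ℕ} (b : Fin n → Fin n → ℝ) (c : Fin n → ℤ) : Fin n → ℝ :=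
  ∑ i, (c i : ℝ) • b i

lemma ip_eq_dotProduct {n : ℕ} (v w : Fin n → ℝ) : ip v w = v ⬝ᵥ w := rfl

lemma nsq_eq_ip {n : ℕ} (v : Fin n → ℝ) : nsq v = ip v v := by
  simp [nsq, ip, pow_two]

lemma ip_add_left {n : ℕ} (v w x : Fin n → ℝ) : ip (v + w) x = ip v x + ip w x := by
  simp [ip_eq_dotProduct]

lemma ip_sub_left {n : ℕ} (v w x : Fin n → ℝ) : ip (v - w) x = ip v x - ip w x := by
  simp [ip_eq_dotProduct, sub_dotProduct]

lemma ip_smul_left {n : ℕ} (a : ℝ) (v x : Fin n → ℝ) : ip (a • v) x = a * ip v x := by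
  simp [ip_eq_dotProduct]

lemma ip_comm {n : ℕ} (v w : Fin n → ℝ) : ip v w = ip w v :=
  dotProduct_comm v w

/-- The reflection in the hyperplane orthogonal to the unit vector `u`. -/
def hyperplaneReflection {n : ℕ} (u x : Fin n → ℝ) : Fin n → ℝ := x - (2 * ip x u) • u

section hyperplaneReflection

variable {n : ℕ} {u : Fin n → ℝ}

lemma ip_hyperplaneReflection_left (x w : Fin n → ℝ) :
    ip (hyperplaneReflection u x) w = ip x w - 2 * ip x u * ip u w := by
  rw [hyperplaneReflection, ip_sub_left, ip_smul_left]

lemma ip_hyperplaneReflection_self (hu : nsq u = 1) (x : Fin n → ℝ) :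
    ip (hyperplaneReflection u x) u = -ip x u := by
  rw [ip_hyperplaneReflection_left, ← nsq_eq_ip, hu]
  ring

lemma hyperplaneReflection_involutive (hu : nsq u = 1) :
    Function.Involutive (hyperplaneReflection u) := by
  intro x
  rw [hyperplaneReflection, ip_hyperplaneReflection_self hu, hyperplaneReflection]
  module

lemma nsq_hyperplaneReflection (hu : nsq u = 1) (x : Fin n → ℝ) :
    nsq (hyperplaneReflection u x) = nsq x := by
  rw [nsq_eq_ip, ip_hyperplaneReflection_left, ip_comm x, ip_hyperplaneReflection_left,
    ip_comm u (hyperplaneReflection u x), ip_hyperplaneReflection_self hu, ← nsq_eq_ip,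
    ip_comm u x]
  ring

end hyperplaneReflection

lemma LV_injective {n : ℕ} {b : Fin n → Fin n → ℝ} (hb : LinearIndependent ℝ b) :
    Function.Injective (LV b) := by
  intro c d h
  have h' := Fintype.linearIndependent_iff.mp hb (fun i => (c i : ℝ) - d i) (by
    simp only [sub_smul, Finset.sum_sub_distrib]
    exact sub_eq_zero.mpr h)
  ext i
  exact_mod_cast sub_eq_zero.mp (h' i)

/-- A sum over a lattice stable under an involution `r` of a function that is odd under `r`
vanishes. -/
lemma tsum_lattice_eq_zero_of_odd {n : ℕ} {b : Fin n → Fin n → ℝ} (hb : LinearIndependent ℝ b)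
    {r : (Fin n → ℝ) → Fin n → ℝ} (hr : Function.Involutive r)
    (hrΛ : ∀ c, ∃ d, r (LV b c) = LV b d)
    {f : (Fin n → ℝ) → ℂ} (hf : ∀ x, f (r x) = -f x) :
    ∑' c : Fin n → ℤ, f (LV b c) = 0 := by
  choose s hs using hrΛ
  have hs_inv : Function.Involutive s := fun c =>
    LV_injective hb (by rw [← hs, ← hs, hr])
  have h := (hs_inv.toPerm s).tsum_eq (fun c => f (LV b c))
  simp only [Function.Involutive.coe_toPerm, ← hs, hf, tsum_neg] at h
  exact self_eq_neg.mp h.symm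

lemma exists_unit_orthogonal {n : ℕ} (hn : 2 ≤ n) (u : Fin n → ℝ) :
    ∃ v : Fin n → ℝ, nsq v = 1 ∧ ip u v = 0 := by
  have hker : LinearMap.ker (dotProductBilin ℝ ℝ u) ≠ ⊥ :=
    LinearMap.ker_ne_bot_of_finrank_lt (by simp; omega)
  obtain ⟨w, hw, hw0⟩ := Submodule.exists_mem_ne_zero_of_ne_bot hker
  have huw : ip u w = 0 := by simpa [ip_eq_dotProduct] using hw
  have hpos : 0 < nsq w := by
    rw [nsq_eq_ip, ip_eq_dotProduct]
    refine lt_of_le_of_ne ?_ fun h => hw0 (dotProduct_self_eq_zero.mp h.symm)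
    exact Finset.sum_nonneg fun i _ => mul_self_nonneg _
  refine ⟨(√(nsq w))⁻¹ • w, ?_, ?_⟩
  · rw [nsq_eq_ip, ip_smul_left, ip_comm, ip_smul_left, ← nsq_eq_ip, ← mul_assoc, ← mul_inv,
      Real.mul_self_sqrt hpos.le, inv_mul_cancel₀ hpos.ne']
  · rw [ip_comm, ip_smul_left, ip_comm, huw, mul_zero]

/-- The symmetric matrix of the quadratic form `x ↦ ⟨x, u⟩⟨x, v⟩`. -/
def symmProductMatrix {n : ℕ} (u v : Fin n → ℝ) : Matrix (Fin n) (Fin n) ℝ :=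
  Matrix.of fun i j => (u i * v j + v i * u j) / 2

lemma symmProductMatrix_isSymm {n : ℕ} (u v : Fin n → ℝ) : (symmProductMatrix u v).IsSymm := by
  ext i j
  simp only [symmProductMatrix, Matrix.transpose_apply, Matrix.of_apply]
  ring

lemma trace_symmProductMatrix {n : ℕ} (u v : Fin n → ℝ) :
    (symmProductMatrix u v).trace = ip u v := by
  refine Finset.sum_congr rfl fun i _ => ?_
  simp only [symmProductMatrix, Matrix.diag_apply, Matrix.of_apply]
  ring

lemma QF_symmProductMatrix {n : ℕ} (u v x : Fin n → ℝ) :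
    QF (symmProductMatrix u v) x = ip x u * ip x v := by
  have h : QF (symmProductMatrix u v) x =
      (ip x u * ip x v + ip x v * ip x u) / 2 := by
    simp only [QF, symmProductMatrix, Matrix.of_apply, ip, Finset.sum_mul_sum,
      ← Finset.sum_add_distrib, Finset.sum_div]
    refine Finset.sum_congr rfl fun i _ => Finset.sum_congr rfl fun j _ => ?_
    ring
  rw [h]
  ring

/-- Let `Λ ⊂ ℝⁿ` (`n ≥ 2`) be a lattice invariant under the reflection
`ρ(x) = x − 2⟨x,u⟩u` in the hyperplane orthogonal to the unit vector `u`.  Then there is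
a nonzero harmonic homogeneous quadratic polynomial `h` with `Θ_{h;Λ} ≡ 0`; explicitly,
in orthonormal coordinates `x₁ = ⟨·,u⟩`, `x₂ = ⟨·,v⟩` (with `v` a unit vector orthogonal
to `u`, so that `ρ*x₁ = −x₁` and `ρ*x₂ = x₂`) one has `Θ_{x₁x₂;Λ} = 0`. -/
theorem reflection_invariant_lattice_has_vanishing_harmonic_theta
    (n : ℕ) (hn : 2 ≤ n)
    (b : Fin n → Fin n → ℝ)
    (hb : LinearIndependent ℝ b) (hspan : Submodule.span ℝ (Set.range b) = ⊤)
    (Λ : Set (Fin n → ℝ)) (hΛ : Λ = {x | ∃ c : Fin n → ℤ, x = LV b c})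
    (u : Fin n → ℝ) (hu : nsq u = 1)
    (hρΛ : (fun x : Fin n → ℝ => x - (2 * ip x u) • u) '' Λ = Λ) :
    (∃ B : Matrix (Fin n) (Fin n) ℝ, B.IsSymm ∧ B.trace = 0 ∧ B ≠ 0 ∧
      ∀ τ : ℂ, 0 < τ.im →
        ∑' c : Fin n → ℤ, ((QF B (LV b c) : ℝ) : ℂ) * eq2 (nsq (LV b c)) τ = 0) ∧
    (∀ v : Fin n → ℝ, nsq v = 1 → ip u v = 0 →
      ∀ τ : ℂ, 0 < τ.im →
        ∑' c : Fin n → ℤ, ((ip (LV b c) u * ip (LV b c) v : ℝ) : ℂ) *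
          eq2 (nsq (LV b c)) τ = 0) := by
  have hrΛ : ∀ c, ∃ d, hyperplaneReflection u (LV b c) = LV b d := by
    subst hΛ
    intro c
    exact hρΛ.subset ⟨LV b c, ⟨c, rfl⟩, rfl⟩
  have htheta : ∀ v : Fin n → ℝ, ip u v = 0 → ∀ τ : ℂ,
      ∑' c : Fin n → ℤ, ((ip (LV b c) u * ip (LV b c) v : ℝ) : ℂ) *
        eq2 (nsq (LV b c)) τ = 0 := by
    intro v huv τ
    refine tsum_lattice_eq_zero_of_odd hb (hyperplaneReflection_involutive hu) hrΛ
      (f := fun x => ((ip x u * ip x v : ℝ) : ℂ) * eq2 (nsq x) τ) fun x => ?_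
    rw [nsq_hyperplaneReflection hu, ip_hyperplaneReflection_self hu,
      ip_hyperplaneReflection_left, huv]
    push_cast
    ring
  refine ⟨?_, fun v _ huv τ _ => htheta v huv τ⟩
  obtain ⟨v, hv, huv⟩ := exists_unit_orthogonal hn u
  refine ⟨symmProductMatrix u v, symmProductMatrix_isSymm u v,
    (trace_symmProductMatrix u v).trans huv, fun h0 => ?_, fun τ _ => ?_⟩
  · have h := QF_symmProductMatrix u v (u + v)
    rw [h0, ip_add_left, ip_add_left, ip_comm v u, huv, ← nsq_eq_ip, ← nsq_eq_ip, hu, hv] at h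
    simp [QF] at h
  · simpa only [QF_symmProductMatrix] using htheta v huv τ
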